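/- Let f ∈ F_{μ,L}(ℝⁿ) with minimizer x_*, let 0 ≤ ε ≤ 2μ/(L+μ), and let 0 ≤ γ ≤ (2μ − ε(L+μ))/((1−ε)μ(L+μ)). If x₁ = x₀ − γd where ‖d − g(x₀)‖ ≤ ε‖g(x₀)‖, then ‖g(x₁)‖ ≤ (1 − (1−ε)μγ)·‖g(x₀)‖. -/

import Mathlib

open scoped RealInnerProductSpace

lemma aux_line {E : Type*} [NormedAddCommGroup E] [InnerProductSpace ℝ E] [CompleteSpace E]
    (f : E → ℝ) (hdiff : Differentiable ℝ f) (x v : E) (t : ℝ) :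
    HasDerivAt (fun t : ℝ => f (x + t • v)) ⟪gradient f (x + t • v), v⟫ t := by
  have h1 := (hdiff (x + t • v)).hasGradientAt.hasFDerivAt
  have h2 : HasDerivAt (fun t : ℝ => x + t • v) v t := by
    simpa using ((hasDerivAt_id t).smul_const v).const_add x
  have h3 := h1.comp_hasDerivAt t h2
  refine h3.congr_deriv ?_
  simp

lemma aux_upper {E : Type*} [NormedAddCommGroup E] [InnerProductSpace ℝ E] [CompleteSpace E]
    (f : E → ℝ) (hdiff : Differentiable ℝ f) (L : ℝ)
    (hlip : ∀ x y, ‖gradient f x - gradient f y‖ ≤ L * ‖x - y‖) (x v : E) :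
    f (x + v) ≤ f x + ⟪gradient f x, v⟫ + L / 2 * ‖v‖ ^ 2 := by
  have hd : ∀ t : ℝ, HasDerivAt
      (fun t : ℝ => f (x + t • v) - t * ⟪gradient f x, v⟫ - t ^ 2 * (L / 2 * ‖v‖ ^ 2))
      (⟪gradient f (x + t • v), v⟫ - ⟪gradient f x, v⟫ - 2 * t * (L / 2 * ‖v‖ ^ 2)) t := by
    intro t
    have h1 := aux_line f hdiff x v t
    have h2 := (hasDerivAt_id t).mul_const ⟪gradient f x, v⟫
    have h3 := (hasDerivAt_pow 2 t).mul_const (L / 2 * ‖v‖ ^ 2)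
    refine ((h1.sub h2).sub h3).congr_deriv ?_
    simp
  have hanti : AntitoneOn
      (fun t : ℝ => f (x + t • v) - t * ⟪gradient f x, v⟫ - t ^ 2 * (L / 2 * ‖v‖ ^ 2))
      (Set.Ici 0) := by
    apply antitoneOn_of_deriv_nonpos (convex_Ici 0)
    · exact fun t _ => (hd t).continuousAt.continuousWithinAt
    · exact fun t _ => (hd t).differentiableAt.differentiableWithinAt
    · intro t ht
      rw [interior_Ici] at ht
      have ht' : 0 < t := ht
      rw [(hd t).deriv, ← inner_sub_left]
      have h1 := real_inner_le_norm (gradient f (x + t • v) - gradient f x) v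
      have h2 := hlip (x + t • v) x
      rw [add_sub_cancel_left, norm_smul, Real.norm_eq_abs, abs_of_pos ht'] at h2
      have h3 := mul_le_mul_of_nonneg_right h2 (norm_nonneg v)
      nlinarith
  have := hanti (Set.mem_Ici.2 le_rfl) (Set.mem_Ici.2 zero_le_one) zero_le_one
  have hg : ⟪gradient f x, v⟫ = fderiv ℝ f x v := by simp
  simp at this
  linarith

lemma aux_lower {E : Type*} [NormedAddCommGroup E] [InnerProductSpace ℝ E] [CompleteSpace E]
    (f : E → ℝ) (hdiff : Differentiable ℝ f) (μ : ℝ)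
    (hsc : ConvexOn ℝ Set.univ (fun x => f x - μ / 2 * ‖x‖ ^ 2)) (x v : E) :
    f x + ⟪gradient f x, v⟫ + μ / 2 * ‖v‖ ^ 2 ≤ f (x + v) := by
  have hn : ∀ t : ℝ, ‖x + t • v‖ ^ 2 = ‖x‖ ^ 2 + t * (2 * ⟪x, v⟫) + t ^ 2 * ‖v‖ ^ 2 := by
    intro t
    rw [norm_add_sq_real, inner_smul_right, norm_smul, mul_pow, Real.norm_eq_abs, sq_abs]
    ring
  have hc : ConvexOn ℝ Set.univ (fun t : ℝ => f (x + t • v) - μ / 2 * ‖x + t • v‖ ^ 2) := by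
    refine ⟨convex_univ, fun s _ t _ a b ha hb hab => ?_⟩
    have := hsc.2 (Set.mem_univ (x + s • v)) (Set.mem_univ (x + t • v)) ha hb hab
    have he : x + (a • s + b • t) • v = a • (x + s • v) + b • (x + t • v) := by
      have : x = (a + b) • x := by rw [hab, one_smul]
      simp only [smul_eq_mul]
      nth_rewrite 1 [this]
      module
    simp only [he]
    exact this
  have hd : HasDerivAt (fun t : ℝ => f (x + t • v) - μ / 2 * ‖x + t • v‖ ^ 2)
      (⟪gradient f x, v⟫ - μ / 2 * (2 * ⟪x, v⟫)) 0 := by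
    simp only [hn]
    have h1 := aux_line f hdiff x v 0
    have h2 := (hasDerivAt_id (0:ℝ)).mul_const (2 * ⟪x, v⟫)
    have h3 := (hasDerivAt_pow 2 (0:ℝ)).mul_const (‖v‖ ^ 2)
    refine (h1.sub (((h2.const_add (‖x‖ ^ 2)).add h3).const_mul (μ / 2))).congr_deriv ?_
    simp
  have := hc.le_slope_of_hasDerivAt (Set.mem_univ 0) (Set.mem_univ 1) zero_lt_one hd
  rw [slope_def_field] at this
  simp only [hn] at this
  have hg : ⟪gradient f x, v⟫ = fderiv ℝ f x v := by simp
  simp at this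
  linarith

lemma aux_half {E : Type*} [NormedAddCommGroup E] [InnerProductSpace ℝ E] [CompleteSpace E]
    (f : E → ℝ) (hdiff : Differentiable ℝ f) (μ L : ℝ) (hμL : μ < L)
    (hsc : ConvexOn ℝ Set.univ (fun x => f x - μ / 2 * ‖x‖ ^ 2))
    (hlip : ∀ x y, ‖gradient f x - gradient f y‖ ≤ L * ‖x - y‖) (x v q : E)
    (hq : gradient f (x + v) = gradient f x + μ • v + q) :
    f x + ⟪gradient f x, v⟫ + μ / 2 * ‖v‖ ^ 2 + 1 / (2 * (L - μ)) * ‖q‖ ^ 2 ≤ f (x + v) := by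
  have hM : 0 < L - μ := by linarith
  obtain ⟨k, hk⟩ : ∃ k, k = 1 / (L - μ) := ⟨_, rfl⟩
  have h1 := aux_lower f hdiff μ hsc x (v - k • q)
  have h2 := aux_upper f hdiff L hlip (x + v) (-(k • q))
  have he : x + v + -(k • q) = x + (v - k • q) := by abel
  rw [he, hq] at h2
  rw [norm_sub_sq_real] at h1
  simp only [inner_sub_right, inner_add_left, inner_neg_right, inner_smul_right, inner_smul_left,
    norm_neg, norm_smul, mul_pow, Real.norm_eq_abs, sq_abs, real_inner_self_eq_norm_sq,
    RCLike.conj_to_real] at h1 h2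
  have hk1 : (L - μ) * k ^ 2 = k := by rw [hk]; field_simp
  have hk2 : 1 / (2 * (L - μ)) = k / 2 := by rw [hk]; field_simp
  rw [hk2]
  have hk3 : L * k ^ 2 * ‖q‖ ^ 2 = (μ * k ^ 2 + k) * ‖q‖ ^ 2 := by
    rw [show L * k ^ 2 = μ * k ^ 2 + k by linarith]
  nlinarith

lemma aux_interp {E : Type*} [NormedAddCommGroup E] [InnerProductSpace ℝ E] [CompleteSpace E]
    (f : E → ℝ) (hdiff : Differentiable ℝ f) (μ L : ℝ) (hμL : μ < L)
    (hsc : ConvexOn ℝ Set.univ (fun x => f x - μ / 2 * ‖x‖ ^ 2))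
    (hlip : ∀ x y, ‖gradient f x - gradient f y‖ ≤ L * ‖x - y‖) (x v : E) :
    ‖gradient f (x + v) - gradient f x - ((L + μ) / 2) • v‖ ≤ (L - μ) / 2 * ‖v‖ := by
  have hM : 0 < L - μ := by linarith
  obtain ⟨q, hq⟩ : ∃ q, gradient f (x + v) = gradient f x + μ • v + q :=
    ⟨gradient f (x + v) - gradient f x - μ • v, by abel⟩
  have h1 := aux_half f hdiff μ L hμL hsc hlip x v q hq
  have h2 := aux_half f hdiff μ L hμL hsc hlip (x + v) (-v) (-q) (by
    rw [hq, add_neg_cancel_right]; module)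
  rw [add_neg_cancel_right, hq] at h2
  simp only [inner_add_left, inner_neg_right, inner_smul_left, norm_neg,
    real_inner_self_eq_norm_sq, RCLike.conj_to_real] at h2
  have h3 : 1 / (L - μ) * ‖q‖ ^ 2 ≤ ⟪q, v⟫ := by
    have : 1 / (L - μ) = 1 / (2 * (L - μ)) + 1 / (2 * (L - μ)) := by field_simp; norm_num
    rw [this]; nlinarith
  have h4 : ‖q‖ ^ 2 ≤ (L - μ) * ⟪q, v⟫ := by
    rw [one_div, inv_mul_le_iff₀ hM] at h3; exact h3
  have he : gradient f (x + v) - gradient f x - ((L + μ) / 2) • v = q - ((L - μ) / 2) • v := by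
    rw [hq]; module
  rw [he]
  apply le_of_sq_le_sq _ (by positivity)
  rw [norm_sub_sq_real, inner_smul_right, norm_smul, mul_pow, Real.norm_eq_abs, sq_abs]
  nlinarith

lemma aux_scalar (c r μ γ ε u G : ℝ) (hμ : 0 < μ) (hr : 0 < r) (hc : c = r + μ)
    (hε0 : 0 ≤ ε) (hε1 : ε < 1) (hγ0 : 0 ≤ γ) (hγ : c * μ * γ * (1 - ε) ≤ μ - c * ε)
    (hG : 0 ≤ G) (hu0 : 0 ≤ u) (hu1 : u ≤ 2 * ε * G) :
    0 ≤ (1 - c * γ * (1 - ε)) * G - r * γ * u ∧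
    G ^ 2 - c * γ * (((1 - ε) * G + u) ^ 2 + (1 - ε ^ 2) * G ^ 2)
      + c ^ 2 * γ ^ 2 * ((1 - ε) * G + u) ^ 2 ≤ ((1 - c * γ * (1 - ε)) * G - r * γ * u) ^ 2 := by
  have hc0 : 0 < c := by linarith
  have hcγ : c * γ ≤ 1 := by
    have : (c * γ) * (μ * (1 - ε)) ≤ 1 * (μ * (1 - ε)) := by nlinarith
    exact le_of_mul_le_mul_right this (mul_pos hμ (by linarith))
  constructor
  · have h1 : γ * (c + ε * (2 * r - c)) ≤ 1 := by
      rcases le_total (2 * r) c with h | h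
      · nlinarith [mul_nonneg hγ0 (mul_nonneg hε0 (sub_nonneg.2 h))]
      · have hp : 0 ≤ c + ε * (2 * r - c) := by nlinarith
        have h2 := mul_le_mul_of_nonneg_right hγ hp
        have h3 : (μ - c * ε) * (c + ε * (2 * r - c)) ≤ c * μ * (1 - ε) := by
          have h5 : 0 ≤ c ^ 2 - 2 * r * μ + c * ε * (2 * r - c) := by
            have := mul_nonneg (mul_nonneg hc0.le hε0) (sub_nonneg.2 h)
            rw [hc] at this ⊢
            nlinarith [sq_nonneg r, sq_nonneg μ]
          nlinarith [mul_nonneg hε0 h5]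
        have h4 : 0 < c * μ * (1 - ε) := mul_pos (mul_pos hc0 hμ) (by linarith)
        by_contra hcon
        push Not at hcon
        nlinarith
    have h2 : r * γ * u ≤ r * γ * (2 * ε * G) := by gcongr
    nlinarith [mul_le_mul_of_nonneg_right h1 hG]
  · have hA : 0 ≤ (μ - c * ε) - c * μ * γ * (1 - ε) := by linarith
    have hB : 0 ≤ c - (2 * r + μ) * μ * γ := by
      have : (2 * r + μ) * μ ≤ c * c := by rw [hc]; nlinarith [sq_nonneg r]
      nlinarith
    have key : ((1 - c * γ * (1 - ε)) * G - r * γ * u) ^ 2 -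
      (G ^ 2 - c * γ * (((1 - ε) * G + u) ^ 2 + (1 - ε ^ 2) * G ^ 2)
      + c ^ 2 * γ ^ 2 * ((1 - ε) * G + u) ^ 2) =
      γ * u * (2 * G * ((μ - c * ε) - c * μ * γ * (1 - ε)) + u * (c - (2 * r + μ) * μ * γ)) := by
      rw [hc]; ring
    have : 0 ≤ γ * u * (2 * G * ((μ - c * ε) - c * μ * γ * (1 - ε)) +
      u * (c - (2 * r + μ) * μ * γ)) := by positivity
    linarith

/-- Inexact gradient method with fixed step length on `f ∈ F_{μ,L}(ℝⁿ)`: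
worst-case contraction of the gradient norm. -/
theorem stmt7 {n : ℕ} (f : EuclideanSpace ℝ (Fin n) → ℝ) (μ L : ℝ)
    (hμ : 0 < μ) (hμL : μ < L)
    (hdiff : Differentiable ℝ f)
    -- μ-strong convexity
    (hsc : ConvexOn ℝ Set.univ (fun x => f x - μ / 2 * ‖x‖ ^ 2))
    -- L-Lipschitz gradient
    (hlip : ∀ x y, ‖gradient f x - gradient f y‖ ≤ L * ‖x - y‖)
    (xstar x₀ x₁ d : EuclideanSpace ℝ (Fin n)) (γ ε : ℝ)
    (hmin : ∀ x, f xstar ≤ f x)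
    (hε0 : 0 ≤ ε) (hε1 : ε ≤ 2 * μ / (L + μ))
    (hγ0 : 0 ≤ γ) (hγ1 : γ ≤ (2 * μ - ε * (L + μ)) / ((1 - ε) * μ * (L + μ)))
    (hstep : x₁ = x₀ - γ • d)
    (hd : ‖d - gradient f x₀‖ ≤ ε * ‖gradient f x₀‖) :
    ‖gradient f x₁‖ ≤ (1 - (1 - ε) * μ * γ) * ‖gradient f x₀‖ := by
  have hε : ε < 1 := lt_of_le_of_lt hε1 (by rw [div_lt_one (by linarith)]; linarith)
  have hγ2 : γ * ((1 - ε) * μ * (L + μ)) ≤ 2 * μ - ε * (L + μ) := by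
    rwa [le_div_iff₀ (mul_pos (mul_pos (by linarith) hμ) (by linarith))] at hγ1
  have hI := aux_interp f hdiff μ L hμL hsc hlip x₀ (-(γ • d))
  rw [← sub_eq_add_neg, ← hstep, norm_neg, norm_smul, Real.norm_eq_abs, abs_of_nonneg hγ0] at hI
  set g := gradient f x₀
  set g1 := gradient f x₁
  have hn1 : ‖g‖ - ‖d - g‖ ≤ ‖d‖ := by
    have := norm_sub_le d (d - g)
    rw [sub_sub_cancel] at this; linarith
  have hn2 : ‖d‖ ≤ ‖g‖ + ‖d - g‖ := by
    have := norm_add_le g (d - g)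
    rwa [add_sub_cancel] at this
  obtain ⟨hs1, hs2⟩ := aux_scalar ((L + μ) / 2) ((L - μ) / 2) μ γ ε (‖d‖ - (1 - ε) * ‖g‖) ‖g‖ hμ
    (by linarith) (by ring) hε0 hε hγ0 (by linarith) (norm_nonneg _) (by linarith) (by linarith)
  have hsq : ‖d - g‖ ^ 2 ≤ (ε * ‖g‖) ^ 2 := by gcongr
  rw [norm_sub_sq_real, real_inner_comm] at hsq
  have hA : ‖g - ((L + μ) / 2 * γ) • d‖ ≤ (1 - (L + μ) / 2 * γ * (1 - ε)) * ‖g‖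
      - (L - μ) / 2 * γ * (‖d‖ - (1 - ε) * ‖g‖) := by
    apply le_of_sq_le_sq _ hs1
    refine le_trans ?_ hs2
    rw [norm_sub_sq_real, inner_smul_right, norm_smul, mul_pow, Real.norm_eq_abs, sq_abs]
    have h0 : 0 ≤ (L + μ) / 2 * γ := mul_nonneg (by linarith) hγ0
    nlinarith [mul_le_mul_of_nonneg_left hsq h0]
  have he : g1 = (g1 - g - ((L + μ) / 2) • (-(γ • d))) + (g - ((L + μ) / 2 * γ) • d) := by module
  have hf := norm_add_le (g1 - g - ((L + μ) / 2) • (-(γ • d))) (g - ((L + μ) / 2 * γ) • d)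
  rw [← he] at hf
  nlinarith
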